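/- Let y ∈ Y = OG(n, C_{2n}[z]) and a ∈ C ∪ {∞}. The Wronskian Wr(y;z) is divisible by (z+a)^{2k} if and only if y ∈ Y_σ(a) for some strict partition σ ∈ Σ with |σ| = k. -/

import Mathlib

open Polynomial OnePoint

namespace OG

/-! ### Tableaux, diagrams, jeu de taquin / tableau switching -/

/-- A cell `(row, column)` (0-indexed). -/
abbrev Cell := ℕ × ℕ

/-- A filling: a finite set of (cell, entry) pairs. -/
abbrev Filling := Finset (Cell × ℕ)

def cellsOf (f : Filling) : Finset Cell := f.image Prod.fst

def entriesOf (f : Filling) : Finset ℕ := f.image Prod.snd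

/-- A (perforated/partial) standard filling: at most one entry per cell, all entries
distinct, and entries strictly increase along rows and down columns. -/
def IsPartialTableau (f : Filling) : Prop :=
  (∀ p ∈ f, ∀ q ∈ f, p.1 = q.1 → p = q) ∧
  (∀ p ∈ f, ∀ q ∈ f, p.2 = q.2 → p = q) ∧
  (∀ p ∈ f, ∀ q ∈ f, p.1.1 = q.1.1 → p.1.2 < q.1.2 → p.2 < q.2) ∧
  (∀ p ∈ f, ∀ q ∈ f, p.1.2 = q.1.2 → p.1.1 < q.1.1 → p.2 < q.2)

/-- A standard tableau on the diagram `D` with entry set `E`. -/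
def IsTableauOn (f : Filling) (D : Finset Cell) (E : Finset ℕ) : Prop :=
  IsPartialTableau f ∧ cellsOf f = D ∧ entriesOf f = E

/-- One elementary switch of the tableau switching (jeu de taquin) algorithm:
an entry `u` of the inner (sliding) family `p.2` at cell `c` is interchanged with an
entry `t` of the outer family `p.1` lying immediately east or south of `c`, provided
both families remain partial standard tableaux. -/
def SwitchStep (p q : Filling × Filling) : Prop :=
  ∃ c u d t, (c, u) ∈ p.2 ∧ (d, t) ∈ p.1 ∧
    (d = (c.1, c.2 + 1) ∨ d = (c.1 + 1, c.2)) ∧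
    q.1 = insert (c, t) (p.1.erase (d, t)) ∧
    q.2 = insert (d, u) (p.2.erase (c, u)) ∧
    IsPartialTableau q.1 ∧ IsPartialTableau q.2

/-- `Switched T U A B`: applying the tableau switching algorithm to the outer tableau `T`
and the inner tableau `U` terminates with `A` (the rectification of `T`) inside and
`B` (the new outer tableau) outside. -/
def Switched (T U A B : Filling) : Prop :=
  Relation.ReflTransGen SwitchStep (T, U) (A, B) ∧ ∀ q, ¬ SwitchStep (A, B) q

/-- `R` is the jeu de taquin rectification of the skew tableau `T` whose inner
(empty) region is the diagram `Din`. -/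
def RectifiesTo (T : Filling) (Din : Finset Cell) (R : Filling) : Prop :=
  ∃ U B, IsTableauOn U Din (Finset.Icc 1 Din.card) ∧ Switched T U R B

/-- Dual equivalence of two skew tableaux with common inner diagram `Din`:
switching with any standard tableau `U` of shape `Din` produces the same outer
tableau `Û`. -/
def DualEquiv (Din : Finset Cell) (T T' : Filling) : Prop :=
  ∀ U A A' B B', IsTableauOn U Din (Finset.Icc 1 Din.card) →
    Switched T U A B → Switched T' U A' B' → B = B'

/-- A partition `λ` with at most `n` parts, each of size at most `n+1`
(the indexing set `Λ` for the Schubert classes of `Gr(n, 2n+1)`). -/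
structure PartitionIn (n : ℕ) where
  part : ℕ → ℕ
  antitone : Antitone part
  head_le : part 0 ≤ n + 1
  vanish : ∀ i, n ≤ i → part i = 0

/-- The weight `|λ|` of a partition. -/
def wt (n : ℕ) (lam : PartitionIn n) : ℕ := ∑ i ∈ Finset.range n, lam.part i

/-- The Young diagram of a partition `λ ∈ Λ`. -/
def partDiag (n : ℕ) (lam : PartitionIn n) : Finset Cell :=
  (Finset.range n ×ˢ Finset.range (n+1)).filter fun c => c.2 < lam.part c.1

/-- The `n × (n+1)` rectangular diagram `⊞`. -/
def rectDiag (n : ℕ) : Finset Cell := Finset.range n ×ˢ Finset.range (n+1)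

/-- A standard Young tableau of rectangular shape `⊞`, with entries `1, …, n(n+1)`. -/
def IsSYTRect (n : ℕ) (T : Filling) : Prop :=
  IsTableauOn T (rectDiag n) (Finset.Icc 1 (n*(n+1)))

/-- A strict partition with all parts distinct, of size at most `n`, and at most
`n` parts (the indexing set `Σ` for Schubert classes of `OG(n, 2n+1)`). -/
structure StrictPartitionIn (n : ℕ) where
  part : ℕ → ℕ
  le_n : ∀ i, part i ≤ n
  strict : ∀ i, part i = 0 ∨ part (i+1) < part i

/-- The weight `|σ|` of a strict partition. -/
def swt (n : ℕ) (s : StrictPartitionIn n) : ℕ := ∑ i ∈ Finset.range n, s.part i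

/-- The shifted diagram of a strict partition: row `i` has `σ i` boxes starting
at column `i`. -/
def shiftedDiag (n : ℕ) (s : StrictPartitionIn n) : Finset Cell :=
  (Finset.range n ×ˢ Finset.range (2*n)).filter fun c => c.1 ≤ c.2 ∧ c.2 < c.1 + s.part c.1

/-- The staircase strict partition `δ = (n > n-1 > … > 1)`. -/
def staircase (n : ℕ) : StrictPartitionIn n where
  part i := n - i
  le_n i := Nat.sub_le n i
  strict i := by
    show n - i = 0 ∨ n - (i+1) < n - i
    omega

/-- A standard shifted tableau of staircase shape `δ`, with entries `1, …, n(n+1)/2`. -/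
def IsSSTstaircase (n : ℕ) (T : Filling) : Prop :=
  IsTableauOn T (shiftedDiag n (staircase n)) (Finset.Icc 1 (n*(n+1)/2))

/-- The partition `σ̃` associated to a strict partition `σ`:
`σ̃ⁱ = σⁱ + #{j : j ≤ i < j + σʲ}` (0-indexed). -/
def tildeFun {n : ℕ} (s : StrictPartitionIn n) (i : ℕ) : ℕ :=
  s.part i + ((Finset.range n).filter fun j => j ≤ i ∧ i < j + s.part j).card

/-- Doubling a shifted (skew) tableau `T` to a symmetrical tableau `T⋆`: an entry `k` at
shifted cell `(i,j)` produces the even entry `2k` at `(i, j+1)` and the odd entry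
`2k-1` at the transposed cell `(j, i)`. -/
def doubleFill (T : Filling) : Filling :=
  T.image (fun p => ((p.1.1, p.1.2 + 1), 2 * p.2)) ∪
  T.image (fun p => ((p.1.2, p.1.1), 2 * p.2 - 1))

/-- Deleting the odd entries of a tableau, dividing the remaining entries by `2` and
shifting each remaining cell one column to the left. -/
def halveFill (T : Filling) : Filling :=
  (T.filter fun p => 2 ∣ p.2).image fun p => ((p.1.1, p.1.2 - 1), p.2 / 2)

/-- A rectangular standard tableau is symmetrical if whenever `2k-1` occupies cell
`(i,j)`, the entry `2k` occupies cell `(j, i+1)` (0-indexed version of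
`i₂ₖ = j₂ₖ₋₁`, `j₂ₖ = i₂ₖ₋₁ + 1`). -/
def IsSymmetrical (T : Filling) : Prop :=
  ∀ i j k : ℕ, 1 ≤ k → ((i, j), 2*k - 1) ∈ T → ((j, i + 1), 2*k) ∈ T

/-- The subtableau `T_{[i,j]}` of entries lying in the interval `[i, j]`. -/
def subTab (T : Filling) (i j : ℕ) : Filling := T.filter fun p => i ≤ p.2 ∧ p.2 ≤ j

/-- The subtableau `T_{<i}`. -/
def lowTab (T : Filling) (i : ℕ) : Filling := T.filter fun p => p.2 < i

/-- The subtableau `T_{>j}`. -/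
def highTab (T : Filling) (j : ℕ) : Filling := T.filter fun p => j < p.2

/-! ### The Grassmannian, the Wronski map and the orthogonal Grassmannian -/

/-- The Wronskian of an `n`-tuple of polynomials. -/
noncomputable def wronskian (n : ℕ) (f : Fin n → ℂ[X]) : ℂ[X] :=
  (Matrix.of fun i j : Fin n => (fun p : ℂ[X] => derivative p)^[(i : ℕ)] (f j)).det

/-- `x` is a point of `X = Gr(n, C_{2n}[z])`: an `n`-dimensional subspace of the
space of polynomials of degree at most `2n`. -/
def IsGrassPt (n : ℕ) (x : Submodule ℂ ℂ[X]) : Prop :=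
  x ≤ degreeLT ℂ (2*n+1) ∧ Module.finrank ℂ x = n

/-- `Wr(x; z) = h(z)` up to a nonzero scalar: some (hence any) basis of `x` has
Wronskian a nonzero scalar multiple of `h`. -/
def WrEq (n : ℕ) (x : Submodule ℂ ℂ[X]) (h : ℂ[X]) : Prop :=
  ∃ f : Fin n → ℂ[X], Submodule.span ℂ (Set.range f) = x ∧
    ∃ c : ℂ, c ≠ 0 ∧ wronskian n f = c • h

/-- The symmetric bilinear form
`⟨Σ aₖ zᵏ/k!, Σ bₗ zˡ/l!⟩ = Σ_{m} (-1)ᵐ aₘ b_{2n-m}` on `C_{2n}[z]`. -/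
noncomputable def form (n : ℕ) (p q : ℂ[X]) : ℂ :=
  ∑ m ∈ Finset.range (2*n+1),
    (-1 : ℂ)^m * (Nat.factorial m : ℂ) * (Nat.factorial (2*n-m) : ℂ) *
      p.coeff m * q.coeff (2*n-m)

/-- `y` is a point of the orthogonal Grassmannian `Y = OG(n, C_{2n}[z])`:
an `n`-dimensional isotropic subspace. -/
def IsOGPt (n : ℕ) (y : Submodule ℂ ℂ[X]) : Prop :=
  IsGrassPt n y ∧ ∀ p ∈ y, ∀ q ∈ y, form n p q = 0

/-- The flag `F_•(a)`, for `a ∈ ℂ ∪ {∞}` (with `none` playing the role of `∞`):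
`F_i(a)` is the space of polynomials of degree at most `2n` divisible by
`(z+a)^{2n+1-i}`, and `F_i(∞) = C_{i-1}[z]`. -/
noncomputable def flag (n : ℕ) (a : Option ℂ) (i : ℕ) : Submodule ℂ ℂ[X] :=
  match a with
  | Option.none => degreeLT ℂ i
  | Option.some a0 =>
    { carrier := {p : ℂ[X] | p ∈ degreeLT ℂ (2*n+1) ∧ (X + C a0)^(2*n+1-i) ∣ p}
      add_mem' := fun hp hq => ⟨add_mem hp.1 hq.1, dvd_add hp.2 hq.2⟩
      zero_mem' := ⟨zero_mem _, dvd_zero _⟩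
      smul_mem' := by
        rintro c p ⟨h1, h2⟩
        refine ⟨Submodule.smul_mem _ _ h1, ?_⟩
        rw [Polynomial.smul_eq_C_mul]
        exact h2.mul_left _ }

/-- The Schubert variety `X_λ(a) ⊆ X` relative to the flag `F_•(a)`. -/
def SchubertX (n : ℕ) (lam : PartitionIn n) (a : Option ℂ) : Set (Submodule ℂ ℂ[X]) :=
  {x | IsGrassPt n x ∧
    ∀ i < n, i + 1 ≤ Module.finrank ℂ ↥(x ⊓ flag n a (n + 2 + i - lam.part i))}

/-- The Schubert variety `Y_σ(a) = Y ∩ X_{σ̃}(a) ⊆ Y`. -/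
def SchubertY (n : ℕ) (s : StrictPartitionIn n) (a : Option ℂ) : Set (Submodule ℂ ℂ[X]) :=
  {y | IsOGPt n y ∧
    ∀ i < n, i + 1 ≤ Module.finrank ℂ ↥(y ⊓ flag n a (n + 2 + i - tildeFun s i))}

/-! ### `ℝP¹`, fibres of the Wronski map, zones and the correspondence -/

/-- The inclusion `ℝP¹ = ℝ ∪ {∞} ↪ ℂ ∪ {∞}`. -/
def toC (t : OnePoint ℝ) : Option ℂ := Option.map (fun r : ℝ => (r : ℂ)) t

/-- The linear factor `z + a` associated to `a ∈ ℝP¹` (equal to `1` for `a = ∞`). -/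
noncomputable def linFactor (t : OnePoint ℝ) : ℂ[X] :=
  (toC t).elim 1 fun a0 => X + C a0

/-- The polynomial `∏_{aᵢ ≠ ∞} (z + aᵢ)` associated to a multiset `a` of points
of `ℝP¹`. -/
noncomputable def fibrePoly (a : Multiset (OnePoint ℝ)) : ℂ[X] := (a.map linFactor).prod

/-- The fibre `X(a)` of the Wronski map over `∏_{aᵢ ≠ ∞} (z + aᵢ)`. -/
def fibre (n : ℕ) (a : Multiset (OnePoint ℝ)) : Set (Submodule ℂ ℂ[X]) :=
  {x | IsGrassPt n x ∧ WrEq n x (fibrePoly a)}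

/-- The total order `⪯` on `ℝP¹` refining `|a| ≤ |b|`:
`a ⪯ b` iff `a = b`, `|a| < |b|`, or `0 < a = -b < ∞`. -/
def ple (x y : OnePoint ℝ) : Prop :=
  x = y ∨ (y = (∞ : OnePoint ℝ) ∧ x ≠ (∞ : OnePoint ℝ)) ∨
    ∃ r s : ℝ, x = (r : OnePoint ℝ) ∧ y = (s : OnePoint ℝ) ∧
      (|r| < |s| ∨ (0 < r ∧ r = -s))

/-- The multiset `{v 1, …, v N}`. -/
def msOfN (N : ℕ) (v : ℕ → OnePoint ℝ) : Multiset (OnePoint ℝ) :=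
  (Finset.Icc 1 N).val.map v

/-- `v 1 ⪯ v 2 ⪯ … ⪯ v N`. -/
def SortedOn (N : ℕ) (v : ℕ → OnePoint ℝ) : Prop :=
  ∀ k l, 1 ≤ k → k ≤ l → l ≤ N → ple (v k) (v l)

/-- The `⪯`-zone of `A` determined by a choice of signs `ε`. -/
def zoneN (N : ℕ) (eps : ℕ → Bool) : Set (ℕ → OnePoint ℝ) :=
  {v | SortedOn N v ∧ ∀ k, 1 ≤ k → k ≤ N →
    (v k = (∞ : OnePoint ℝ) ∨
      ∃ r : ℝ, v k = (r : OnePoint ℝ) ∧ (if eps k then 0 ≤ r else r ≤ 0))}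

/-- The doubled multiset `b⋆ = {b₁, b₁, …, b_M, b_M}`. -/
def starMs (M : ℕ) (v : ℕ → OnePoint ℝ) : Multiset (OnePoint ℝ) :=
  msOfN M v + msOfN M v

/-- The polynomial with coefficient vector `v`. -/
noncomputable def polyOfVec {m : ℕ} (v : Fin m → ℂ) : ℂ[X] :=
  ∑ i, C (v i) * X ^ (i : ℕ)

/-- The topology of the Grassmannian `Gr(n, C_{2n}[z])`: the quotient (coinduced)
topology along the map sending a linearly independent `n`-tuple of coefficient
vectors to its span. -/
noncomputable def grassTop (n : ℕ) : TopologicalSpace (Submodule ℂ ℂ[X]) :=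
  TopologicalSpace.coinduced
    (fun M : {M : Fin n → Fin (2*n+1) → ℂ // LinearIndependent ℂ M} =>
      Submodule.span ℂ (Set.range fun i => polyOfVec (M.1 i)))
    inferInstance

/-- The tangent space at `x` to the Schubert variety `X_λ(a)` (at a point of the
open cell), viewed inside `Hom(x, ℂ[z]/x)`: the maps `φ` with
`φ(x ∩ F_j(a)) ⊆ (F_j(a) + x)/x` for all `j`. -/
def tangentSchubertSet (n : ℕ) (a : Option ℂ) (x : Submodule ℂ ℂ[X]) :
    Set (↥x →ₗ[ℂ] (ℂ[X] ⧸ x)) :=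
  {φ | ∀ j ≤ 2*n+1, ∀ v : x, (v : ℂ[X]) ∈ flag n a j →
      φ v ∈ (flag n a j ⊔ x).map x.mkQ}

/-- The tangent space at an isotropic `x` to the orthogonal Grassmannian `Y`,
inside `Hom(x, ℂ[z]/x)`: the maps `φ` with `⟨φ v, w⟩ + ⟨v, φ w⟩ = 0`. -/
def tangentYSet (n : ℕ) (x : Submodule ℂ ℂ[X]) : Set (↥x →ₗ[ℂ] (ℂ[X] ⧸ x)) :=
  {φ | ∀ v w : x, ∀ pv pw : ℂ[X],
      x.mkQ pv = φ v → x.mkQ pw = φ w →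
      form n pv (w : ℂ[X]) + form n (v : ℂ[X]) pw = 0}

/-- Divisibility of `h` by `(z+a)^k`, where for `a = ∞` this means
`deg h ≤ n(n+1) - k`. -/
def rootMultCond (n : ℕ) (a : Option ℂ) (k : ℕ) (h : ℂ[X]) : Prop :=
  match a with
  | Option.some a0 => (X + C a0)^k ∣ h
  | Option.none => h.natDegree + k ≤ n*(n+1)

/-- The characterizing properties (i)-(v) of the correspondence
`(T, a) ↦ x_T(a)` of Theorem 2.3:
(i) `x_T(a)` lies in the fibre `X(a)`;
(ii) `T ↦ x_T(a)` is surjective onto `X(a)`, and injective when `a` is a set;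
(iii) `a ↦ x_T(a)` is continuous on every `⪯`-zone;
(iv) if `a_i = … = a_j` in the `⪯`-sorted order then `x_T(a) ∈ X_λ(a_i)` where `λ`
is the rectification shape of `T_{[i,j]}`;
(v) under the hypotheses of (iv), if `T_{<i} = T'_{<i}` and `T_{>j} = T'_{>j}` then
`x_T(a) = x_{T'}(a)` iff `T_{[i,j]}` and `T'_{[i,j]}` are dual equivalent. -/
structure CorrProps (n : ℕ)
    (xmap : Filling → Multiset (OnePoint ℝ) → Submodule ℂ ℂ[X]) : Prop where
  mem_fibre : ∀ T a, IsSYTRect n T → Multiset.card a = n*(n+1) →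
    xmap T a ∈ fibre n a
  surj : ∀ a, Multiset.card a = n*(n+1) → ∀ x ∈ fibre n a,
    ∃ T, IsSYTRect n T ∧ xmap T a = x
  inj : ∀ a, Multiset.card a = n*(n+1) → Multiset.Nodup a →
    ∀ T T', IsSYTRect n T → IsSYTRect n T' → xmap T a = xmap T' a → T = T'
  contOn : ∀ T, IsSYTRect n T → ∀ eps : ℕ → Bool,
    @ContinuousOn (ℕ → OnePoint ℝ) (Submodule ℂ ℂ[X]) _ (grassTop n)
      (fun v => xmap T (msOfN (n*(n+1)) v)) (zoneN (n*(n+1)) eps)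
  schub : ∀ v : ℕ → OnePoint ℝ, SortedOn (n*(n+1)) v →
    ∀ i j, 1 ≤ i → i ≤ j → j ≤ n*(n+1) → (∀ k, i ≤ k → k ≤ j → v k = v i) →
    ∀ T, IsSYTRect n T →
    ∀ lam : PartitionIn n, ∀ R : Filling,
      RectifiesTo (subTab T i j) (cellsOf (lowTab T i)) R →
      cellsOf R = partDiag n lam →
      xmap T (msOfN (n*(n+1)) v) ∈ SchubertX n lam (toC (v i))
  dual : ∀ v : ℕ → OnePoint ℝ, SortedOn (n*(n+1)) v →
    ∀ i j, 1 ≤ i → i ≤ j → j ≤ n*(n+1) → (∀ k, i ≤ k → k ≤ j → v k = v i) →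
    ∀ T T', IsSYTRect n T → IsSYTRect n T' →
      lowTab T i = lowTab T' i → highTab T j = highTab T' j →
      (xmap T (msOfN (n*(n+1)) v) = xmap T' (msOfN (n*(n+1)) v) ↔
        DualEquiv (cellsOf (lowTab T i)) (subTab T i j) (subTab T' i j))



/-! ### Combinatorics -/

section Comb

variable {n : ℕ} {d : ℕ → ℕ}

lemma comb_inj (hmono : ∀ i j, i < j → j < n → d i < d j)
    (hsym : ∀ i j, i < n → j < n → d i + d j ≠ 2 * n) :
    Set.InjOn (fun i => (n - d i) + (d i - n)) (Finset.range n : Set ℕ) := by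
  intro i hi j hj hij
  simp only [Finset.coe_range, Set.mem_Iio] at hi hj
  have h1 := hsym i j hi hj
  simp only at hij
  rcases lt_trichotomy i j with h | h | h
  · have := hmono i j h hj; omega
  · exact h
  · have := hmono j i h hi; omega

lemma comb_image (hmono : ∀ i j, i < j → j < n → d i < d j)
    (hle : ∀ i, i < n → d i ≤ 2 * n)
    (hsym : ∀ i j, i < n → j < n → d i + d j ≠ 2 * n) :
    (Finset.range n).image (fun i => (n - d i) + (d i - n)) = Finset.Icc 1 n := by
  apply Finset.eq_of_subset_of_card_le
  · intro x hx
    simp only [Finset.mem_image, Finset.mem_range, Finset.mem_Icc] at hx ⊢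
    obtain ⟨i, hi, rfl⟩ := hx
    have := hle i hi
    have := hsym i i hi hi
    omega
  · rw [Finset.card_image_of_injOn (comb_inj hmono hsym)]; simp

/-- sum of positive parts -/
lemma comb_sum (hmono : ∀ i j, i < j → j < n → d i < d j)
    (hle : ∀ i, i < n → d i ≤ 2 * n)
    (hsym : ∀ i j, i < n → j < n → d i + d j ≠ 2 * n) :
    2 * (∑ i ∈ Finset.range n, (n - d i)) + ∑ i ∈ Finset.range n, d i =
      n * (n + 1) + ∑ i ∈ Finset.range n, i := by
  have h1 : ∑ i ∈ Finset.range n, ((n - d i) + (d i - n)) = ∑ x ∈ Finset.Icc 1 n, x := by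
    rw [← comb_image hmono hle hsym, Finset.sum_image (comb_inj hmono hsym)]
  have h2 : ∑ x ∈ Finset.Icc 1 n, x = ∑ i ∈ Finset.range n, (i + 1) := by
    rw [Finset.range_eq_Ico, Finset.sum_Ico_add' (fun i => i) 0 n 1]
    rfl
  have h3 : ∑ i ∈ Finset.range n, ((n - d i) + d i) =
      ∑ i ∈ Finset.range n, (n + (d i - n)) := by
    apply Finset.sum_congr rfl; intros; omega
  simp only [Finset.sum_add_distrib, Finset.sum_const, Finset.card_range, smul_eq_mul,
    mul_one] at h1 h2 h3
  have : n * (n + 1) = n * n + n := by ring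
  omega

/-- at most `g` indices `j` have `d j` within `g` of `n`. -/
lemma comb_window (hmono : ∀ i j, i < j → j < n → d i < d j)
    (hsym : ∀ i j, i < n → j < n → d i + d j ≠ 2 * n) (g : ℕ) (s : Finset ℕ)
    (hs : ∀ j ∈ s, j < n ∧ n ≤ d j + g ∧ d j ≤ n + g) : s.card ≤ g := by
  have h1 : s.card = (s.image (fun i => (n - d i) + (d i - n))).card := by
    rw [Finset.card_image_of_injOn]
    apply (comb_inj hmono hsym).mono
    intro j hj
    simpa using (hs j hj).1
  rw [h1]
  calc _ ≤ (Finset.Icc 1 g).card := by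
        apply Finset.card_le_card
        intro x hx
        simp only [Finset.mem_image, Finset.mem_Icc] at hx ⊢
        obtain ⟨i, hi, rfl⟩ := hx
        have := hs i hi
        have := hsym i i this.1 this.1
        omega
    _ = g := by simp

lemma comb_window_ge (hmono : ∀ i j, i < j → j < n → d i < d j)
    (hle : ∀ i, i < n → d i ≤ 2 * n)
    (hsym : ∀ i j, i < n → j < n → d i + d j ≠ 2 * n) (g : ℕ) (hg : g ≤ n) (s : Finset ℕ)
    (hs : ∀ j, j < n → n ≤ d j + g → d j ≤ n + g → j ∈ s) : g ≤ s.card := by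
  calc g = (Finset.Icc 1 g).card := by simp
    _ ≤ (s.image (fun i => (n - d i) + (d i - n))).card := by
        apply Finset.card_le_card
        intro x hx
        have hx' : x ∈ Finset.Icc 1 n := by
          simp only [Finset.mem_Icc] at hx ⊢; omega
        rw [← comb_image hmono hle hsym] at hx'
        simp only [Finset.mem_image, Finset.mem_range, Finset.mem_Icc] at hx hx' ⊢
        obtain ⟨i, hi, rfl⟩ := hx'
        exact ⟨i, hs i hi (by omega) (by omega), rfl⟩
    _ ≤ s.card := Finset.card_image_le

lemma comb_mono_add (hmono : ∀ i j, i < j → j < n → d i < d j) (i j : ℕ) (hij : i ≤ j)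
    (hj : j < n) : d i + (j - i) ≤ d j := by
  induction j, hij using Nat.le_induction with
  | base => simp
  | succ k hk ih =>
    have := ih (by omega)
    have := hmono k (k+1) (by omega) hj
    omega

/-- The tautological strict partition attached to `d`. -/
def tauPart (n : ℕ) (d : ℕ → ℕ) (hmono : ∀ i j, i < j → j < n → d i < d j) :
    StrictPartitionIn n where
  part i := if i < n then n - d i else 0
  le_n i := by split_ifs <;> omega
  strict i := by
    by_cases h : i + 1 < n
    · have := hmono i (i+1) (by omega) h
      have h' : i < n := by omega
      simp only [h, h', if_true]; omega
    · simp only [h, if_false]; omega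

/-- greedy truncation -/
def truncPart {n : ℕ} (s : StrictPartitionIn n) (k : ℕ) : StrictPartitionIn n where
  part i := min (s.part i) (k - ∑ j ∈ Finset.range i, s.part j)
  le_n i := le_trans (min_le_left _ _) (s.le_n i)
  strict i := by
    have := s.strict i
    rw [Finset.sum_range_succ]
    omega

lemma trunc_sum (s : StrictPartitionIn n) (k m : ℕ) :
    ∑ i ∈ Finset.range m, (truncPart s k).part i = min k (∑ i ∈ Finset.range m, s.part i) := by
  induction m with
  | zero => simp
  | succ m ih =>
    rw [Finset.sum_range_succ, ih, Finset.sum_range_succ]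
    simp only [truncPart]
    omega

lemma tilde_mono (s t : StrictPartitionIn n) (h : ∀ i, s.part i ≤ t.part i) (i : ℕ) :
    tildeFun s i ≤ tildeFun t i := by
  unfold tildeFun
  apply Nat.add_le_add (h i)
  apply Finset.card_le_card
  intro j hj
  rw [Finset.mem_filter] at hj ⊢
  have := h j
  exact ⟨hj.1, hj.2.1, by omega⟩

lemma hook_le (s : StrictPartitionIn n) (i : ℕ) :
    ((Finset.range n).filter fun j => j ≤ i ∧ i < j + s.part j).card ≤ i + 1 := by
  calc _ ≤ (Finset.range (i+1)).card := by
        apply Finset.card_le_card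
        intro j hj
        simp only [Finset.mem_filter, Finset.mem_range] at hj ⊢
        omega
    _ = i + 1 := by simp

lemma tau_bound (hmono : ∀ i j, i < j → j < n → d i < d j)
    (hle : ∀ i, i < n → d i ≤ 2 * n)
    (hsym : ∀ i j, i < n → j < n → d i + d j ≠ 2 * n) (i : ℕ) (hi : i < n) :
    d i + tildeFun (tauPart n d hmono) i ≤ n + 1 + i := by
  have hh := hook_le (tauPart n d hmono) i
  unfold tildeFun
  by_cases hd : d i ≤ n
  · have : (tauPart n d hmono).part i = n - d i := by simp [tauPart, hi]
    omega
  · have h0 : (tauPart n d hmono).part i = 0 := by simp [tauPart]; omega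
    rw [h0]
    push Not at hd
    have hdi := hle i hi
    -- number of indices with d j + d i < 2n
    set u := ((Finset.range (i+1)).filter fun j => d j + d i < 2 * n).card with hu
    set v := ((Finset.range (i+1)).filter fun j => ¬ d j + d i < 2 * n).card with hv
    have huv : u + v = i + 1 := by
      rw [hu, hv, Finset.card_filter_add_card_filter_not]; simp
    have hlt_of : ∀ l, l < n → d l ≤ d i → l ≤ i := by
      intro l hl hdl
      by_contra hcon
      have := hmono i l (by omega) hl
      omega
    have hcl : ((Finset.range n).filter fun j => j ≤ i ∧
        i < j + (tauPart n d hmono).part j).card ≤ u := by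
      apply Finset.card_le_card
      intro j hj
      have hj2 := (Finset.mem_filter.mp hj).2
      have hjn : j < n := Finset.mem_range.mp (Finset.mem_filter.mp hj).1
      obtain ⟨hji, hlt⟩ := hj2
      have hpj : (tauPart n d hmono).part j = n - d j := by simp [tauPart, hjn]
      rw [hpj] at hlt
      simp only [Finset.mem_filter, Finset.mem_range]
      refine ⟨by omega, ?_⟩
      by_contra hcon
      have hne := hsym j i hjn hi
      have hw : n - d j ≤ (Finset.Ico j i).card := by
        apply comb_window_ge hmono hle hsym _ (by omega)
        intro l hl h1 h2
        rw [Finset.mem_Ico]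
        constructor
        · by_contra hc
          have := hmono l j (by omega) hjn
          omega
        · have := hlt_of l hl (by omega)
          rcases Nat.lt_or_ge l i with h | h
          · exact h
          · have : l = i := by omega
            subst this
            omega
      rw [Nat.card_Ico] at hw
      omega
    have : d i - n ≤ v := by
      apply comb_window_ge hmono hle hsym _ (by omega)
      intro l hl h1 h2
      simp only [Finset.mem_filter, Finset.mem_range]
      have := hlt_of l hl (by omega)
      omega
    omega

lemma comb_b (hmono : ∀ i j, i < j → j < n → d i < d j)
    (hsym : ∀ i j, i < n → j < n → d i + d j ≠ 2 * n) (i : ℕ) (hi : i < n) :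
    ((Finset.range i).filter fun j => n + j ≤ d j + i).card + i ≤ d i := by
  set W := (Finset.range i).filter fun j => n + j ≤ d j + i with hW
  have hi0 : i ≤ d i := by
    have := comb_mono_add hmono 0 i (by omega) hi
    omega
  rcases W.eq_empty_or_nonempty with h | h
  · rw [h]; simpa using hi0
  · obtain ⟨u, hu, hmin⟩ : ∃ u ∈ W, ∀ x ∈ W, u ≤ x :=
      ⟨W.min' h, W.min'_mem h, fun x hx => W.min'_le x hx⟩
    have hu' := hu
    simp only [hW, Finset.mem_filter, Finset.mem_range] at hu'
    have hc : W.card ≤ i - u := by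
      rw [← Nat.card_Ico]
      apply Finset.card_le_card
      intro x hx
      have h1 := hmin x hx
      simp only [hW, Finset.mem_filter, Finset.mem_range] at hx
      rw [Finset.mem_Ico]
      omega
    by_contra hcon
    have hw : (Finset.Icc u i).card ≤ i - u := by
      apply comb_window hmono hsym
      intro l hl
      rw [Finset.mem_Icc] at hl
      have := comb_mono_add hmono l i (by omega) hi
      have := comb_mono_add hmono u l (by omega) (by omega)
      omega
    rw [Nat.card_Icc] at hw
    omega

lemma tilde_sum (s : StrictPartitionIn n) :
    ∑ i ∈ Finset.range n, tildeFun s i + ∑ i ∈ Finset.range n, (i + s.part i - n) =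
      2 * ∑ i ∈ Finset.range n, s.part i := by
  have h1 : ∑ i ∈ Finset.range n,
      ((Finset.range n).filter fun j => j ≤ i ∧ i < j + s.part j).card =
      ∑ j ∈ Finset.range n, ((Finset.range n).filter fun i => j ≤ i ∧ i < j + s.part j).card :=
    Finset.sum_card_bipartiteAbove_eq_sum_card_bipartiteBelow
      (fun i j => j ≤ i ∧ i < j + s.part j)
  have h2 : ∀ j ∈ Finset.range n,
      ((Finset.range n).filter fun i => j ≤ i ∧ i < j + s.part j).card + (j + s.part j - n)
        = s.part j := by
    intro j hj
    rw [Finset.mem_range] at hj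
    have : (Finset.range n).filter (fun i => j ≤ i ∧ i < j + s.part j) =
        Finset.Ico j (min n (j + s.part j)) := by
      ext x
      rw [Finset.mem_filter, Finset.mem_range, Finset.mem_Ico]
      omega
    rw [this, Nat.card_Ico]
    omega
  have h3 : _ = ∑ i ∈ Finset.range n, s.part i := Finset.sum_congr rfl h2
  rw [Finset.sum_add_distrib] at h3
  unfold tildeFun
  rw [Finset.sum_add_distrib, h1]
  omega

lemma schubert_bound (hmono : ∀ i j, i < j → j < n → d i < d j)
    (hsym : ∀ i j, i < n → j < n → d i + d j ≠ 2 * n) (s : StrictPartitionIn n)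
    (hs : ∀ i, i < n → d i + tildeFun s i ≤ n + 1 + i) :
    2 * ∑ i ∈ Finset.range n, s.part i + ∑ i ∈ Finset.range n, d i ≤
      n * (n + 1) + ∑ i ∈ Finset.range n, i := by
  -- overflow is controlled by the sets `Y i`
  have ha : ∀ i ∈ Finset.range n, i + s.part i - n ≤
      ((Finset.range n).filter fun j => j < i ∧ j + s.part j ≤ i ∧ d j + i < n + j).card := by
    intro i hi
    rw [Finset.mem_range] at hi
    by_cases hov : i + s.part i ≤ n
    · omega
    · have h1 := hs i hi
      have hb := comb_b hmono hsym i hi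
      unfold tildeFun at h1
      have h2 : (Finset.range (i+1)).filter (fun j => i < j + s.part j) ⊆
          (Finset.range n).filter fun j => j ≤ i ∧ i < j + s.part j := by
        intro x hx
        rw [Finset.mem_filter, Finset.mem_range] at hx ⊢
        omega
      have h2' := Finset.card_le_card h2
      have h3 := Finset.card_filter_add_card_filter_not (s := Finset.range (i+1))
        (fun j => i < j + s.part j)
      rw [Finset.card_range] at h3
      have h4 : (Finset.range (i+1)).filter (fun j => ¬ i < j + s.part j) ⊆
          ((Finset.range n).filter fun j => j < i ∧ j + s.part j ≤ i ∧ d j + i < n + j) ∪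
          ((Finset.range i).filter fun j => n + j ≤ d j + i) := by
        intro x hx
        rw [Finset.mem_filter, Finset.mem_range] at hx
        have hxi : x ≠ i := by rintro rfl; omega
        rw [Finset.mem_union, Finset.mem_filter, Finset.mem_filter, Finset.mem_range,
          Finset.mem_range]
        omega
      have h4' := (Finset.card_le_card h4).trans (Finset.card_union_le _ _)
      omega
  have hc : ∀ j ∈ Finset.range n,
      ((Finset.range n).filter fun i => j < i ∧ j + s.part j ≤ i ∧ d j + i < n + j).card
        + (d j + tildeFun s j) ≤ n + 1 + j := by
    intro j hj
    rw [Finset.mem_range] at hj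
    have h1 := hs j hj
    have hh := hook_le s j
    have hsub : ((Finset.range n).filter fun i =>
        j < i ∧ j + s.part j ≤ i ∧ d j + i < n + j) ⊆
        Finset.Ico (j + s.part j) (n + j - d j) := by
      intro x hx
      rw [Finset.mem_filter, Finset.mem_range] at hx
      rw [Finset.mem_Ico]
      omega
    have hc := Finset.card_le_card hsub
    rw [Nat.card_Ico] at hc
    unfold tildeFun at h1 ⊢
    omega
  have hdc : ∑ i ∈ Finset.range n, ((Finset.range n).filter fun j =>
        j < i ∧ j + s.part j ≤ i ∧ d j + i < n + j).card =
      ∑ j ∈ Finset.range n, ((Finset.range n).filter fun i =>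
        j < i ∧ j + s.part j ≤ i ∧ d j + i < n + j).card :=
    Finset.sum_card_bipartiteAbove_eq_sum_card_bipartiteBelow
      (fun i j => j < i ∧ j + s.part j ≤ i ∧ d j + i < n + j)
  have h1 := Finset.sum_le_sum ha
  have h2 := Finset.sum_le_sum hc
  have h3 := tilde_sum s
  have hS : ∑ j ∈ Finset.range n, (n + 1 + j) = n * (n + 1) + ∑ j ∈ Finset.range n, j := by
    rw [Finset.sum_add_distrib, Finset.sum_const, Finset.card_range, smul_eq_mul]
  rw [hS] at h2
  simp only [Finset.sum_add_distrib] at h2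
  omega

lemma comb_main (hmono : ∀ i j, i < j → j < n → d i < d j)
    (hle : ∀ i, i < n → d i ≤ 2 * n)
    (hsym : ∀ i j, i < n → j < n → d i + d j ≠ 2 * n) (k : ℕ) :
    2 * k + ∑ i ∈ Finset.range n, d i ≤ n * (n + 1) + ∑ i ∈ Finset.range n, i ↔
      ∃ s : StrictPartitionIn n, swt n s = k ∧
        ∀ i, i < n → d i + tildeFun s i ≤ n + 1 + i := by
  constructor
  · intro h
    refine ⟨truncPart (tauPart n d hmono) k, ?_, ?_⟩
    · unfold swt
      rw [trunc_sum]
      have h1 := comb_sum hmono hle hsym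
      have h2 : ∑ i ∈ Finset.range n, (tauPart n d hmono).part i =
          ∑ i ∈ Finset.range n, (n - d i) := by
        apply Finset.sum_congr rfl
        intro i hi
        simp [tauPart, Finset.mem_range.mp hi]
      omega
    · intro i hi
      have h1 := tau_bound hmono hle hsym i hi
      have h2 := tilde_mono (truncPart (tauPart n d hmono) k) (tauPart n d hmono)
        (fun i => min_le_left _ _) i
      omega
  · rintro ⟨s, rfl, hs⟩
    exact schubert_bound hmono hsym s hs

end Comb

/-! ### Linear algebra -/

section LinAlg

open Classical in
/-- The set of degrees of nonzero elements. -/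
noncomputable def degSet (N : ℕ) (V : Submodule ℂ ℂ[X]) : Finset ℕ :=
  (Finset.range N).filter fun e => ∃ p ∈ V, p ≠ 0 ∧ p.natDegree = e

lemma linInd_of_natDegree {ι : Type*} (f : ι → ℂ[X]) (h0 : ∀ i, f i ≠ 0)
    (hinj : Function.Injective fun i => (f i).natDegree) : LinearIndependent ℂ f := by
  classical
  rw [linearIndependent_iff']
  intro s g hg
  by_contra hcon
  push Not at hcon
  obtain ⟨i0, hi0, hgi0⟩ := hcon
  obtain ⟨m, hm, hmax⟩ := Finset.exists_max_image (s.filter fun i => g i ≠ 0)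
    (fun i => (f i).natDegree) ⟨i0, by simp [hi0, hgi0]⟩
  rw [Finset.mem_filter] at hm
  have hc := congrArg (fun p : ℂ[X] => p.coeff (f m).natDegree) hg
  simp only [finsetSum_coeff, coeff_smul, smul_eq_mul, coeff_zero] at hc
  rw [Finset.sum_eq_single m] at hc
  · have : (f m).leadingCoeff ≠ 0 := leadingCoeff_ne_zero.mpr (h0 m)
    rcases mul_eq_zero.mp hc with h | h
    · exact hm.2 h
    · exact this h
  · intro b hb hbm
    by_cases hgb : g b = 0
    · simp [hgb]
    · have h1 := hmax b (by simp [hb, hgb])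
      have h2 : (f b).natDegree ≠ (f m).natDegree := fun h => hbm (hinj h)
      rw [coeff_eq_zero_of_natDegree_lt (by omega), mul_zero]
  · intro h; exact absurd hm.1 h

lemma span_of_natDegree {ι : Type*} (V : Submodule ℂ ℂ[X]) (f : ι → ℂ[X]) (hf : ∀ i, f i ∈ V)
    (h0 : ∀ i, f i ≠ 0) (hall : ∀ p ∈ V, p ≠ 0 → ∃ i, (f i).natDegree = p.natDegree) :
    Submodule.span ℂ (Set.range f) = V := by
  apply le_antisymm
  · rw [Submodule.span_le]
    rintro _ ⟨i, rfl⟩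
    exact hf i
  · intro p hp
    induction hN : p.natDegree using Nat.strong_induction_on generalizing p with
    | _ N ih =>
      by_cases hp0 : p = 0
      · rw [hp0]; exact zero_mem _
      obtain ⟨i, hi⟩ := hall p hp hp0
      have hfi : f i ∈ Submodule.span ℂ (Set.range f) := Submodule.subset_span ⟨i, rfl⟩
      set c := p.leadingCoeff / (f i).leadingCoeff with hc
      have hl : (f i).leadingCoeff ≠ 0 := leadingCoeff_ne_zero.mpr (h0 i)
      have hlp : p.leadingCoeff ≠ 0 := leadingCoeff_ne_zero.mpr hp0
      have hcne : c ≠ 0 := div_ne_zero hlp hl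
      set q := p - c • f i with hq
      have hqV : q ∈ V := V.sub_mem hp (V.smul_mem _ (hf i))
      have hpq : p = q + c • f i := by rw [hq]; ring
      rw [hpq]
      refine Submodule.add_mem _ ?_ (Submodule.smul_mem _ _ hfi)
      by_cases hq0 : q = 0
      · rw [hq0]; exact zero_mem _
      have hdeg : q.degree < p.degree := by
        apply degree_sub_lt_left
        · rw [smul_eq_C_mul, degree_C_mul hcne, degree_eq_natDegree hp0,
            degree_eq_natDegree (h0 i), hi]
        · exact hp0
        · rw [smul_eq_C_mul, leadingCoeff_mul, leadingCoeff_C, hc]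
          field_simp
      have : q.natDegree < p.natDegree := natDegree_lt_natDegree hq0 hdeg
      exact ih _ (by omega) hqV rfl

lemma degSet_basis (N : ℕ) (V : Submodule ℂ ℂ[X]) (hV : V ≤ degreeLT ℂ N) :
    ∃ f : degSet N V → ℂ[X], (∀ e, f e ∈ V) ∧ (∀ e, f e ≠ 0) ∧
      (∀ e, (f e).natDegree = e) ∧ LinearIndependent ℂ f ∧
      Submodule.span ℂ (Set.range f) = V := by
  classical
  have hch : ∀ e : degSet N V, ∃ p ∈ V, p ≠ 0 ∧ p.natDegree = e := by
    rintro ⟨e, he⟩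
    exact (Finset.mem_filter.mp he).2
  choose f hfV hf0 hfd using hch
  refine ⟨f, hfV, hf0, hfd, linInd_of_natDegree f hf0 ?_, span_of_natDegree V f hfV hf0 ?_⟩
  · intro a b hab
    simp only [hfd] at hab
    exact Subtype.ext hab
  · intro p hp hp0
    have hlt : p.natDegree < N := by
      have := mem_degreeLT.mp (hV hp)
      rwa [degree_eq_natDegree hp0, Nat.cast_lt] at this
    exact ⟨⟨p.natDegree, Finset.mem_filter.mpr ⟨Finset.mem_range.mpr hlt, p, hp, hp0, rfl⟩⟩,
      by rw [hfd]⟩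

lemma finrank_eq_degSet (N : ℕ) (V : Submodule ℂ ℂ[X]) (hV : V ≤ degreeLT ℂ N) :
    Module.finrank ℂ V = (degSet N V).card := by
  obtain ⟨f, _, _, _, hli, hsp⟩ := degSet_basis N V hV
  have h1 := finrank_span_eq_card hli
  rwa [hsp, Fintype.card_coe] at h1

lemma degSet_inf (N m : ℕ) (V : Submodule ℂ ℂ[X]) :
    degSet N (V ⊓ degreeLT ℂ m) = (degSet N V).filter (· < m) := by
  classical
  ext e
  simp only [degSet, Finset.mem_filter, Finset.mem_range, Submodule.mem_inf, mem_degreeLT]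
  constructor
  · rintro ⟨h, p, ⟨hp, hd⟩, h0, rfl⟩
    rw [degree_eq_natDegree h0, Nat.cast_lt] at hd
    exact ⟨⟨h, p, hp, h0, rfl⟩, hd⟩
  · rintro ⟨⟨h, p, hp, h0, rfl⟩, hd⟩
    refine ⟨h, p, ⟨hp, ?_⟩, h0, rfl⟩
    rwa [degree_eq_natDegree h0, Nat.cast_lt]

lemma finset_enum (D : Finset ℕ) (n : ℕ) (hD : D.card = n) :
    ∃ d : ℕ → ℕ, (∀ i j, i < j → j < n → d i < d j) ∧ (∀ i, i < n → d i ∈ D) ∧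
      ∀ i m, i < n → (i + 1 ≤ (D.filter (· < m)).card ↔ d i < m) := by
  classical
  set e := D.orderEmbOfFin hD with he
  set d : ℕ → ℕ := fun i => if h : i < n then e ⟨i, h⟩ else 0 with hd
  have hdi : ∀ i (h : i < n), d i = e ⟨i, h⟩ := fun i h => by simp [hd, h]
  have hmono : ∀ i j, i < j → j < n → d i < d j := by
    intro i j hij hj
    rw [hdi i (by omega), hdi j hj]
    exact e.strictMono (by simpa using hij)
  have hmem : ∀ i, i < n → d i ∈ D := by
    intro i hi
    rw [hdi i hi]; exact Finset.orderEmbOfFin_mem _ _ _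
  refine ⟨d, hmono, hmem, ?_⟩
  have hinj : Set.InjOn d (Finset.range n : Set ℕ) := by
    intro i hi j hj hij
    simp only [Finset.coe_range, Set.mem_Iio] at hi hj
    rcases lt_trichotomy i j with h | h | h
    · have := hmono i j h hj; omega
    · exact h
    · have := hmono j i h hi; omega
  have hsurj : ∀ x ∈ D, ∃ j, j < n ∧ d j = x := by
    intro x hx
    have : x ∈ Set.range e := by rw [he, Finset.range_orderEmbOfFin]; exact hx
    obtain ⟨⟨j, hj⟩, rfl⟩ := this
    exact ⟨j, hj, hdi j hj⟩
  intro i m hi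
  constructor
  · intro h
    by_contra hcon
    have hsub : D.filter (· < m) ⊆ (Finset.range i).image d := by
      intro x hx
      rw [Finset.mem_filter] at hx
      obtain ⟨j, hj, rfl⟩ := hsurj x hx.1
      refine Finset.mem_image_of_mem _ (Finset.mem_range.mpr ?_)
      by_contra hc
      rcases Nat.eq_or_lt_of_le (not_lt.mp hc) with h | h
      · subst h; omega
      · have := hmono i j h hj; omega
    have := (Finset.card_le_card hsub).trans Finset.card_image_le
    rw [Finset.card_range] at this
    omega
  · intro h
    have hsub : (Finset.range (i+1)).image d ⊆ D.filter (· < m) := by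
      intro x hx
      rw [Finset.mem_image] at hx
      obtain ⟨j, hj, rfl⟩ := hx
      rw [Finset.mem_range] at hj
      rw [Finset.mem_filter]
      refine ⟨hmem j (by omega), ?_⟩
      rcases Nat.eq_or_lt_of_le (Nat.lt_succ_iff.mp hj) with h' | h'
      · subst h'; exact h
      · have := hmono j i h' hi; omega
    have := Finset.card_le_card hsub
    rw [Finset.card_image_of_injOn (hinj.mono (by
      intro x hx; simp only [Finset.coe_range, Set.mem_Iio] at hx ⊢; omega)),
      Finset.card_range] at this
    exact this

/-- The form pairs complementary degrees nontrivially. -/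
lemma form_ne_zero (n : ℕ) (p q : ℂ[X]) (hp : p ≠ 0) (hq : q ≠ 0)
    (h : p.natDegree + q.natDegree = 2 * n) : form n p q ≠ 0 := by
  unfold form
  rw [Finset.sum_eq_single p.natDegree]
  · have h1 : 2 * n - p.natDegree = q.natDegree := by omega
    rw [h1]
    have hp' : p.coeff p.natDegree ≠ 0 := leadingCoeff_ne_zero.mpr hp
    have hq' : q.coeff q.natDegree ≠ 0 := leadingCoeff_ne_zero.mpr hq
    have := Nat.factorial_ne_zero p.natDegree
    have := Nat.factorial_ne_zero q.natDegree
    simp only [ne_eq, mul_eq_zero, Nat.cast_eq_zero, pow_eq_zero_iff', neg_eq_zero]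
    simp_all
  · intro m hm hne
    rw [Finset.mem_range] at hm
    rcases lt_or_gt_of_ne hne with h' | h'
    · rw [coeff_eq_zero_of_natDegree_lt (p := q) (by omega), mul_zero]
    · rw [coeff_eq_zero_of_natDegree_lt (p := p) (by omega)]; ring
  · intro h'
    exact absurd (Finset.mem_range.mpr (by omega)) h'

lemma wronskian_change (n : ℕ) (f g : Fin n → ℂ[X])
    (h : ∀ j, g j ∈ Submodule.span ℂ (Set.range f)) :
    ∃ c : ℂ, wronskian n g = C c * wronskian n f := by
  have h1 : ∀ j, ∃ c : Fin n → ℂ, ∑ k, c k • f k = g j := fun j =>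
    (Submodule.mem_span_range_iff_exists_fun ℂ).mp (h j)
  choose P hP using h1
  refine ⟨(Matrix.of fun k j => P j k).det, ?_⟩
  unfold wronskian
  have hm : (Matrix.of fun i j : Fin n => (fun p : ℂ[X] => derivative p)^[(i : ℕ)] (g j)) =
      (Matrix.of fun i j : Fin n => (fun p : ℂ[X] => derivative p)^[(i : ℕ)] (f j)) *
        (C.mapMatrix (Matrix.of fun k j => P j k)) := by
    ext1 i j
    rw [Matrix.mul_apply]
    simp only [Matrix.of_apply, RingHom.mapMatrix_apply, Matrix.map_apply]
    rw [← hP j]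
    change derivative^[(i : ℕ)] _ = _
    rw [iterate_derivative_sum]
    apply Finset.sum_congr rfl
    intro k _
    rw [iterate_derivative_smul, smul_eq_C_mul, mul_comm]
  rw [hm, Matrix.det_mul, ← RingHom.map_det, mul_comm]

/-- Data produced from a suitable linear normalisation `Φ` of the flag. -/
lemma reduction (n : ℕ) (y : Submodule ℂ ℂ[X]) (hy : IsOGPt n y) (h : ℂ[X]) (hw : WrEq n y h)
    (a : Option ℂ) (Φ : ℂ[X] →ₗ[ℂ] ℂ[X])
    (hinj : ∀ p ∈ y, Φ p = 0 → p = 0)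
    (hflag : ∀ p ∈ y, ∀ m, p ∈ flag n a m ↔ Φ p ∈ degreeLT ℂ m)
    (hdeg : ∀ p ∈ y, Φ p ∈ degreeLT ℂ (2 * n + 1))
    (hform : ∀ p ∈ y, ∀ q ∈ y, form n (Φ p) (Φ q) = 0)
    (hWr : ∀ (f : Fin n → ℂ[X]) (d : Fin n → ℕ), (∀ j, f j ∈ y) → (∀ j, Φ (f j) ≠ 0) →
      (∀ j, (Φ (f j)).natDegree = d j) → Function.Injective d →
      wronskian n f ≠ 0 ∧ ∀ K, (rootMultCond n a K (wronskian n f) ↔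
        K + ∑ j, d j ≤ n * (n + 1) + ∑ i ∈ Finset.range n, i))
    (hroot : ∀ (c : ℂ) (K : ℕ) (g : ℂ[X]), c ≠ 0 →
      (rootMultCond n a K (C c * g) ↔ rootMultCond n a K g)) :
    ∃ d : ℕ → ℕ, (∀ i j, i < j → j < n → d i < d j) ∧ (∀ i, i < n → d i ≤ 2 * n) ∧
      (∀ i j, i < n → j < n → d i + d j ≠ 2 * n) ∧
      (∀ i m, i < n → (i + 1 ≤ Module.finrank ℂ ↥(y ⊓ flag n a m) ↔ d i < m)) ∧
      ∀ K, rootMultCond n a K h ↔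
        K + ∑ i ∈ Finset.range n, d i ≤ n * (n + 1) + ∑ i ∈ Finset.range n, i := by
  classical
  set V := y.map Φ with hVdef
  have hV : V ≤ degreeLT ℂ (2 * n + 1) := by
    rintro _ ⟨p, hp, rfl⟩; exact hdeg p hp
  have hfr : ∀ W : Submodule ℂ ℂ[X], W ≤ y →
      Module.finrank ℂ (W.map Φ) = Module.finrank ℂ W := by
    intro W hW
    have hi : Function.Injective (Φ.domRestrict W) := by
      rw [injective_iff_map_eq_zero]
      rintro ⟨p, hp⟩ h0
      exact Subtype.ext (hinj p (hW hp) h0)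
    have := LinearMap.finrank_range_of_inj hi
    rwa [LinearMap.range_domRestrict] at this
  have hcard : (degSet (2 * n + 1) V).card = n := by
    rw [← finrank_eq_degSet _ _ hV, hfr y le_rfl, hy.1.2]
  obtain ⟨d, hmono, hmem, hcount⟩ := finset_enum _ n hcard
  have hmem' : ∀ i, i < n → ∃ p ∈ y, Φ p ≠ 0 ∧ (Φ p).natDegree = d i := by
    intro i hi
    obtain ⟨_, ⟨p, hp, rfl⟩, h0, h1⟩ := (Finset.mem_filter.mp (hmem i hi)).2
    exact ⟨p, hp, h0, h1⟩
  refine ⟨d, hmono, ?_, ?_, ?_, ?_⟩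
  · intro i hi
    have := Finset.mem_range.mp (Finset.mem_filter.mp (hmem i hi)).1
    omega
  · intro i j hi hj hij
    obtain ⟨p, hp, hp0, hpd⟩ := hmem' i hi
    obtain ⟨q, hq, hq0, hqd⟩ := hmem' j hj
    exact form_ne_zero n _ _ hp0 hq0 (by omega) (hform p hp q hq)
  · intro i m hi
    rw [← hcount i m hi, ← degSet_inf, ← finrank_eq_degSet _ _ (inf_le_left.trans hV),
      ← hfr _ inf_le_left]
    have : (y ⊓ flag n a m).map Φ = V ⊓ degreeLT ℂ m := by
      ext q
      constructor
      · rintro ⟨p, ⟨hp, hpf⟩, rfl⟩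
        exact ⟨⟨p, hp, rfl⟩, (hflag p hp m).mp hpf⟩
      · rintro ⟨⟨p, hp, rfl⟩, hpf⟩
        exact ⟨p, ⟨hp, (hflag p hp m).mpr hpf⟩, rfl⟩
    rw [this]
  · intro K
    have hch : ∀ j : Fin n, ∃ p ∈ y, Φ p ≠ 0 ∧ (Φ p).natDegree = d j := fun j => hmem' j j.2
    choose f hfy hf0 hfd using hch
    have hdinj : Function.Injective (fun j : Fin n => d j) := by
      intro i j hij
      simp only at hij
      rcases lt_trichotomy (i : ℕ) j with h | h | h
      · have := hmono i j h j.2; omega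
      · exact Fin.ext h
      · have := hmono j i h i.2; omega
    obtain ⟨hne, hiff⟩ := hWr f (fun j => d j) hfy hf0 hfd hdinj
    obtain ⟨f0, hf0s, c, hc, hwr⟩ := hw
    obtain ⟨c', hc'⟩ := wronskian_change n f0 f (fun j => by rw [hf0s]; exact hfy j)
    rw [hwr, smul_eq_C_mul, ← mul_assoc, ← C_mul] at hc'
    have hcc : c' * c ≠ 0 := by
      intro h0
      rw [h0] at hc'
      simp at hc'
      exact hne hc'
    rw [← hroot _ K h hcc, ← hc', hiff K, Fin.sum_univ_eq_sum_range d n]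

end LinAlg

/-! ### Wronskian computations -/

section Wr

lemma det_descFactorial_ne_zero (n : ℕ) (d : Fin n → ℕ) (hd : Function.Injective d) :
    (Matrix.of fun i j : Fin n => ((d j).descFactorial (i : ℕ) : ℂ)).det ≠ 0 := by
  have h1 := Matrix.det_eval_matrixOfPolynomials_eq_det_vandermonde
    (fun j : Fin n => (d j : ℂ)) (fun i : Fin n => descPochhammer ℂ i)
    (fun i => descPochhammer_natDegree ℂ i) (fun i => monic_descPochhammer ℂ i)
  have h2 : (Matrix.vandermonde fun j : Fin n => (d j : ℂ)).det ≠ 0 := by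
    rw [Matrix.det_vandermonde_ne_zero_iff]
    intro i j hij
    have hij2 : (d i : ℂ) = (d j : ℂ) := hij
    exact hd (by exact_mod_cast hij2)
  rw [h1, ← Matrix.det_transpose] at h2
  convert h2 using 2
  ext i j
  simp [descPochhammer_eval_eq_descFactorial]

lemma coeff_euler (i k : ℕ) (p : ℂ[X]) :
    (X ^ i * derivative^[i] p).coeff k = (k.descFactorial i : ℂ) * p.coeff k := by
  rw [coeff_X_pow_mul']
  split_ifs with h
  · rw [coeff_iterate_derivative, nsmul_eq_mul, Nat.sub_add_cancel h]
  · rw [Nat.descFactorial_of_lt (by omega)]; simp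

/-- The Euler matrix. -/
noncomputable def eulerMat (n : ℕ) (f : Fin n → ℂ[X]) : Matrix (Fin n) (Fin n) ℂ[X] :=
  Matrix.of fun i j => X ^ (i : ℕ) * derivative^[(i : ℕ)] (f j)

lemma det_eulerMat (n : ℕ) (f : Fin n → ℂ[X]) :
    (eulerMat n f).det = X ^ (∑ i ∈ Finset.range n, i) * wronskian n f := by
  unfold eulerMat wronskian
  have h := Matrix.det_mul_column (fun i : Fin n => (X : ℂ[X]) ^ (i : ℕ))
    (Matrix.of fun i j : Fin n => (fun p : ℂ[X] => derivative p)^[(i : ℕ)] (f j))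
  rw [Finset.prod_pow_eq_pow_sum, Fin.sum_univ_eq_sum_range (fun i => i) n] at h
  exact h

lemma coeff_prod_top {ι : Type*} (s : Finset ι) (g : ι → ℂ[X]) (d : ι → ℕ)
    (h : ∀ i ∈ s, (g i).natDegree ≤ d i) :
    (∏ i ∈ s, g i).natDegree ≤ ∑ i ∈ s, d i ∧
      (∏ i ∈ s, g i).coeff (∑ i ∈ s, d i) = ∏ i ∈ s, (g i).coeff (d i) := by
  classical
  induction s using Finset.induction_on with
  | empty => simp
  | insert a s ha ih =>
    have ih' := ih (fun i hi => h i (Finset.mem_insert_of_mem hi))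
    have hg := h a (Finset.mem_insert_self _ _)
    rw [Finset.prod_insert ha, Finset.sum_insert ha, Finset.prod_insert ha]
    refine ⟨natDegree_mul_le.trans (Nat.add_le_add hg ih'.1), ?_⟩
    rw [coeff_mul_add_eq_of_natDegree_le hg ih'.1, ih'.2]

lemma det_top (n : ℕ) (M : Matrix (Fin n) (Fin n) ℂ[X]) (d : Fin n → ℕ)
    (h : ∀ i j, (M i j).natDegree ≤ d j) :
    M.det.natDegree ≤ ∑ j, d j ∧
      M.det.coeff (∑ j, d j) = (Matrix.of fun i j => (M i j).coeff (d j)).det := by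
  have hp := fun σ : Equiv.Perm (Fin n) =>
    coeff_prod_top Finset.univ (fun j => M (σ j) j) d (fun j _ => h _ _)
  constructor
  · rw [Matrix.det_apply]
    apply natDegree_sum_le_of_forall_le
    intro σ _
    refine le_trans ?_ (hp σ).1
    rw [Units.smul_def, zsmul_eq_mul]
    refine (natDegree_mul_le).trans ?_
    simp
  · rw [Matrix.det_apply, Matrix.det_apply, finsetSum_coeff]
    apply Finset.sum_congr rfl
    intro σ _
    rw [Units.smul_def, Units.smul_def, coeff_smul, (hp σ).2]
    rfl

lemma wr_infty (n : ℕ) (f : Fin n → ℂ[X]) (d : Fin n → ℕ) (h0 : ∀ j, f j ≠ 0)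
    (hd : ∀ j, (f j).natDegree = d j) (hinj : Function.Injective d) :
    wronskian n f ≠ 0 ∧
      (wronskian n f).natDegree + ∑ i ∈ Finset.range n, i = ∑ j, d j := by
  have hE : ∀ i j, (eulerMat n f i j).natDegree ≤ d j := by
    intro i j
    rw [natDegree_le_iff_coeff_eq_zero]
    intro N hN
    rw [eulerMat, Matrix.of_apply, coeff_euler,
      coeff_eq_zero_of_natDegree_lt (by rw [hd]; exact hN), mul_zero]
  obtain ⟨h1, h2⟩ := det_top n _ d hE
  have h3 : (Matrix.of fun i j => (eulerMat n f i j).coeff (d j)) =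
      Matrix.of fun i j => (f j).leadingCoeff *
        (Matrix.of fun i j : Fin n => ((d j).descFactorial (i : ℕ) : ℂ)) i j := by
    ext i j
    simp only [eulerMat, Matrix.of_apply, coeff_euler, leadingCoeff, hd]
    ring
  have hne : (eulerMat n f).det.coeff (∑ j, d j) ≠ 0 := by
    rw [h2, h3, Matrix.det_mul_row]
    refine mul_ne_zero (Finset.prod_ne_zero_iff.mpr fun j _ => ?_)
      (det_descFactorial_ne_zero n d hinj)
    exact leadingCoeff_ne_zero.mpr (h0 j)
  have hnd : (eulerMat n f).det.natDegree = ∑ j, d j :=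
    le_antisymm h1 (le_natDegree_of_ne_zero hne)
  rw [det_eulerMat] at hnd hne
  have hw : wronskian n f ≠ 0 := by
    intro h; rw [h] at hne; simp at hne
  refine ⟨hw, ?_⟩
  rw [natDegree_mul (pow_ne_zero _ X_ne_zero) hw, natDegree_X_pow] at hnd
  omega

lemma wr_zero (n : ℕ) (f : Fin n → ℂ[X]) (o : Fin n → ℕ)
    (hlow : ∀ j k, k < o j → (f j).coeff k = 0) (hne : ∀ j, (f j).coeff (o j) ≠ 0)
    (hinj : Function.Injective o) :
    wronskian n f ≠ 0 ∧
      ∀ K, X ^ K ∣ wronskian n f ↔ K + ∑ i ∈ Finset.range n, i ≤ ∑ j, o j := by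
  have hE : ∀ i j, ∃ q : ℂ[X], eulerMat n f i j = X ^ (o j) * q := by
    intro i j
    apply (X_pow_dvd_iff).mpr
    intro k hk
    rw [eulerMat, Matrix.of_apply, coeff_euler, hlow j k hk, mul_zero]
  choose N hN using hE
  have hM : eulerMat n f = Matrix.of fun i j => X ^ (o j) * (Matrix.of N) i j := by
    ext1 i j
    rw [hN]; rfl
  have hdet : X ^ (∑ i ∈ Finset.range n, i) * wronskian n f =
      X ^ (∑ j, o j) * (Matrix.of N).det := by
    rw [← det_eulerMat, hM, Matrix.det_mul_row, Finset.prod_pow_eq_pow_sum]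
  have hN0 : ∀ i j, (N i j).coeff 0 = (f j).coeff (o j) * ((o j).descFactorial (i : ℕ) : ℂ) := by
    intro i j
    have h1 := congrArg (fun p : ℂ[X] => p.coeff (o j)) (hN i j)
    simp only [eulerMat, Matrix.of_apply, coeff_euler] at h1
    rw [coeff_X_pow_mul', if_pos le_rfl, Nat.sub_self] at h1
    rw [← h1]; ring
  have hN1 : (Matrix.of N).det.coeff 0 ≠ 0 := by
    rw [← constantCoeff_apply, RingHom.map_det]
    have h3 : constantCoeff.mapMatrix (Matrix.of N) =
      Matrix.of fun i j => (f j).coeff (o j) *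
        (Matrix.of fun i j : Fin n => ((o j).descFactorial (i : ℕ) : ℂ)) i j := by
      ext i j
      simp only [RingHom.mapMatrix_apply, Matrix.map_apply, Matrix.of_apply,
        constantCoeff_apply, hN0]
    rw [h3, Matrix.det_mul_row]
    exact mul_ne_zero (Finset.prod_ne_zero_iff.mpr fun j _ => hne j)
      (det_descFactorial_ne_zero n o hinj)
  constructor
  · intro h
    rw [h, mul_zero] at hdet
    have := mul_eq_zero.mp hdet.symm
    rcases this with h | h
    · exact pow_ne_zero _ X_ne_zero h
    · rw [h] at hN1; simp at hN1
  · intro K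
    have hX : (X : ℂ[X]) ^ (∑ i ∈ Finset.range n, i) ≠ 0 := pow_ne_zero _ X_ne_zero
    rw [← mul_dvd_mul_iff_left hX, hdet, ← pow_add]
    constructor
    · intro h
      by_contra hcon
      rw [X_pow_dvd_iff] at h
      have := h (∑ j, o j) (by omega)
      rw [coeff_X_pow_mul', if_pos le_rfl, Nat.sub_self] at this
      exact hN1 this
    · intro h
      exact (pow_dvd_pow _ (by omega)).trans (dvd_mul_right _ _)

lemma taylor_iterate_derivative (r : ℂ) (i : ℕ) (p : ℂ[X]) :
    taylor r (derivative^[i] p) = derivative^[i] (taylor r p) := by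
  induction i generalizing p with
  | zero => rfl
  | succ i ih =>
    rw [Function.iterate_succ_apply, Function.iterate_succ_apply, ih]
    congr 1
    rw [taylor_apply, taylor_apply, derivative_comp]
    simp

lemma taylor_wronskian (n : ℕ) (r : ℂ) (f : Fin n → ℂ[X]) :
    taylor r (wronskian n f) = wronskian n (fun j => taylor r (f j)) := by
  have h : taylor r (wronskian n f) = taylorAlgHom r (wronskian n f) := rfl
  rw [h]
  unfold wronskian
  rw [AlgHom.map_det]
  congr 1
  ext1 i j
  exact taylor_iterate_derivative r i (f j)

lemma dvd_iff_taylor (a : ℂ) (k : ℕ) (p : ℂ[X]) :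
    (X + C a) ^ k ∣ p ↔ X ^ k ∣ taylor (-a) p := by
  have h := map_dvd_iff (taylorEquiv (-a)) (a := (X + C a) ^ k) (b := p)
  rw [← h, map_pow]
  have h2 : taylorEquiv (-a) (X + C a) = X := by
    change taylor (-a) (X + C a) = X
    simp
  rw [h2]
  rfl

/-- The polynomial whose values are the shifted forms. -/
noncomputable def formPoly (n : ℕ) (p q : ℂ[X]) : ℂ[X] :=
  ∑ m ∈ Finset.range (2*n+1), (-1) ^ m * (derivative^[m] p * derivative^[2*n-m] q)

lemma fact_coeff_taylor (r : ℂ) (m : ℕ) (p : ℂ[X]) :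
    (Nat.factorial m : ℂ) * (taylor r p).coeff m = (derivative^[m] p).eval r := by
  rw [← taylor_coeff_zero, taylor_iterate_derivative, coeff_iterate_derivative]
  simp [Nat.descFactorial_self]

lemma form_taylor (n : ℕ) (r : ℂ) (p q : ℂ[X]) :
    form n (taylor r p) (taylor r q) = (formPoly n p q).eval r := by
  unfold form formPoly
  rw [eval_finsetSum]
  apply Finset.sum_congr rfl
  intro m _
  rw [eval_mul, eval_mul, ← fact_coeff_taylor, ← fact_coeff_taylor]
  simp only [eval_pow, eval_neg, eval_one]
  ring

lemma derivative_formPoly (n : ℕ) (p q : ℂ[X]) (hp : p ∈ degreeLT ℂ (2*n+1))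
    (hq : q ∈ degreeLT ℂ (2*n+1)) : derivative (formPoly n p q) = 0 := by
  have hz : ∀ p : ℂ[X], p ∈ degreeLT ℂ (2*n+1) → derivative^[2*n+1] p = 0 := by
    intro p hp
    by_cases h0 : p = 0
    · simp [h0]
    apply iterate_derivative_eq_zero
    have := mem_degreeLT.mp hp
    rwa [degree_eq_natDegree h0, Nat.cast_lt] at this
  have key : ∀ M, M ≤ 2 * n + 1 →
      derivative (∑ m ∈ Finset.range M,
        (-1 : ℂ[X]) ^ m * (derivative^[m] p * derivative^[2*n-m] q)) =
      p * derivative^[2*n+1] q - (-1) ^ M * (derivative^[M] p * derivative^[2*n+1-M] q) := by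
    intro M
    induction M with
    | zero => intro _; simp
    | succ M ih =>
      intro hM
      rw [Finset.sum_range_succ, derivative_add, ih (by omega)]
      have h1 : derivative ((-1 : ℂ[X]) ^ M) = 0 := by
        have : ((-1 : ℂ[X]) ^ M) = C ((-1) ^ M) := by simp
        rw [this, derivative_C]
      rw [derivative_mul, h1, derivative_mul, ← Function.iterate_succ_apply' derivative,
        ← Function.iterate_succ_apply' derivative]
      have h2 : 2 * n + 1 - M = (2 * n - M).succ := by omega
      have h3 : 2 * n + 1 - (M + 1) = 2 * n - M := by omega
      rw [h2, h3, pow_succ, Nat.succ_eq_add_one]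
      ring
  unfold formPoly
  rw [key _ le_rfl, hz p hp, hz q hq]
  simp

lemma form_taylor_eq (n : ℕ) (r : ℂ) (p q : ℂ[X]) (hp : p ∈ degreeLT ℂ (2*n+1))
    (hq : q ∈ degreeLT ℂ (2*n+1)) :
    form n (taylor r p) (taylor r q) = form n p q := by
  have h0 := form_taylor n 0 p q
  rw [taylor_zero, taylor_zero] at h0
  rw [form_taylor, h0, eq_C_of_derivative_eq_zero (derivative_formPoly n p q hp hq)]
  simp

/-- reflection as a linear map -/
noncomputable def reflLin (N : ℕ) : ℂ[X] →ₗ[ℂ] ℂ[X] where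
  toFun p := reflect N p
  map_add' p q := reflect_add p q N
  map_smul' c p := by simp [smul_eq_C_mul, reflect_C_mul]

lemma form_reflect (n : ℕ) (p q : ℂ[X]) :
    form n (reflect (2*n) p) (reflect (2*n) q) = form n q p := by
  unfold form
  apply Finset.sum_congr rfl
  intro m hm
  rw [Finset.mem_range] at hm
  rw [coeff_reflect, coeff_reflect, revAt_le (by omega), revAt_le (by omega)]
  have : 2 * n - (2 * n - m) = m := by omega
  rw [this]
  ring

lemma reflect_mem_iff (N m : ℕ) (p : ℂ[X]) (hp : p ∈ degreeLT ℂ (N + 1)) :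
    reflect N p ∈ degreeLT ℂ m ↔ X ^ (N + 1 - m) ∣ p := by
  have hp' : ∀ k, N < k → p.coeff k = 0 := by
    intro k hk
    exact coeff_eq_zero_of_degree_lt (lt_of_lt_of_le (mem_degreeLT.mp hp) (by exact_mod_cast hk))
  rw [mem_degreeLT, degree_lt_iff_coeff_zero, X_pow_dvd_iff]
  constructor
  · intro h k hk
    have := h (N - k) (by omega)
    rw [coeff_reflect, revAt_le (by omega)] at this
    rwa [show N - (N - k) = k by omega] at this
  · intro h k hk
    rw [coeff_reflect]
    by_cases hkN : k ≤ N
    · rw [revAt_le hkN]; exact h _ (by omega)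
    · rw [revAt_eq_self_of_lt (by omega)]; exact hp' _ (by omega)

lemma two_mul_sum_range (n : ℕ) : 2 * ∑ i ∈ Finset.range n, i + n = n * n := by
  have := Finset.sum_range_id_mul_two n
  cases n with
  | zero => simp
  | succ n => rw [Nat.add_sub_cancel] at this; nlinarith

lemma exists_data (n : ℕ) (y : Submodule ℂ ℂ[X]) (hy : IsOGPt n y) (h : ℂ[X])
    (hw : WrEq n y h) (a : Option ℂ) :
    ∃ d : ℕ → ℕ, (∀ i j, i < j → j < n → d i < d j) ∧ (∀ i, i < n → d i ≤ 2 * n) ∧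
      (∀ i j, i < n → j < n → d i + d j ≠ 2 * n) ∧
      (∀ i m, i < n → (i + 1 ≤ Module.finrank ℂ ↥(y ⊓ flag n a m) ↔ d i < m)) ∧
      ∀ K, rootMultCond n a K h ↔
        K + ∑ i ∈ Finset.range n, d i ≤ n * (n + 1) + ∑ i ∈ Finset.range n, i := by
  cases a with
  | none =>
    apply reduction n y hy h hw none LinearMap.id
    · intro p _ h; exact h
    · intro p _ m; rfl
    · intro p hp; exact hy.1.1 hp
    · exact hy.2
    · intro f d _ h0 hd hinj
      obtain ⟨h1, h2⟩ := wr_infty n f d h0 hd hinj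
      refine ⟨h1, fun K => ?_⟩
      change (wronskian n f).natDegree + K ≤ n * (n + 1) ↔ _
      omega
    · intro c K g hc
      change (C c * g).natDegree + K ≤ _ ↔ g.natDegree + K ≤ _
      rw [natDegree_C_mul hc]
  | some a =>
    have hT : ∀ p ∈ y, taylor (-a) p ∈ degreeLT ℂ (2 * n + 1) := by
      intro p hp
      rw [mem_degreeLT, degree_taylor]
      exact mem_degreeLT.mp (hy.1.1 hp)
    apply reduction n y hy h hw (Option.some a) ((reflLin (2 * n)).comp (taylor (-a)))
    · intro p _ h
      have h' : reflect (2 * n) (taylor (-a) p) = 0 := h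
      rw [reflect_eq_zero_iff, taylor_eq_zero] at h'
      exact h'
    · intro p hp m
      change (p ∈ degreeLT ℂ (2*n+1) ∧ (X + C a)^(2*n+1-m) ∣ p) ↔
        reflect (2 * n) (taylor (-a) p) ∈ degreeLT ℂ m
      rw [reflect_mem_iff _ _ _ (hT p hp), dvd_iff_taylor]
      exact and_iff_right (hy.1.1 hp)
    · intro p hp
      change reflect (2 * n) (taylor (-a) p) ∈ degreeLT ℂ _
      rw [reflect_mem_iff _ _ _ (hT p hp)]
      simp
    · intro p hp q hq
      change form n (reflect (2 * n) (taylor (-a) p)) (reflect (2 * n) (taylor (-a) q)) = 0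
      rw [form_reflect, form_taylor_eq n _ _ _ (hy.1.1 hq) (hy.1.1 hp)]
      exact hy.2 q hq p hp
    · intro f d hfy h0 hd hinj
      have hd' : ∀ j, (reflect (2 * n) (taylor (-a) (f j))).natDegree = d j := hd
      have h0' : ∀ j, reflect (2 * n) (taylor (-a) (f j)) ≠ 0 := h0
      have hdle : ∀ j, d j ≤ 2 * n := by
        intro j
        have h1 : reflect (2 * n) (taylor (-a) (f j)) ∈ degreeLT ℂ (2 * n + 1) := by
          rw [reflect_mem_iff _ _ _ (hT _ (hfy j))]
          simp
        rw [mem_degreeLT, degree_eq_natDegree (h0' j), hd' j, Nat.cast_lt] at h1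
        omega
      obtain ⟨h1, h2⟩ := wr_zero n (fun j => taylor (-a) (f j)) (fun j => 2 * n - d j)
        (by
          intro j k hk
          have := hdle j
          have h3 : (reflect (2 * n) (taylor (-a) (f j))).coeff (2 * n - k) = 0 :=
            coeff_eq_zero_of_natDegree_lt (by rw [hd' j]; omega)
          rw [coeff_reflect, revAt_le (by omega)] at h3
          rwa [show 2 * n - (2 * n - k) = k by omega] at h3)
        (by
          intro j
          have := hdle j
          have h3 : (reflect (2 * n) (taylor (-a) (f j))).coeff (d j) ≠ 0 := by
            rw [← hd' j]; exact leadingCoeff_ne_zero.mpr (h0' j)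
          rwa [coeff_reflect, revAt_le (by omega)] at h3)
        (by
          intro i j hij
          have := hdle i
          have := hdle j
          simp only at hij
          exact hinj (by omega))
      rw [← taylor_wronskian] at h1 h2
      refine ⟨fun h => h1 (by rw [h, map_zero]), fun K => ?_⟩
      change (X + C a) ^ K ∣ _ ↔ _
      rw [dvd_iff_taylor, h2 K]
      have h4 : ∑ j, (2 * n - d j) + ∑ j, d j = n * (2 * n) := by
        rw [← Finset.sum_add_distrib, Finset.sum_congr rfl
          (fun j _ => Nat.sub_add_cancel (hdle j))]
        simp
      have h5 := two_mul_sum_range n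
      have h6 : n * (2 * n) = 2 * (n * n) := by ring
      have h7 : n * (n + 1) = n * n + n := by ring
      omega
    · intro c K g hc
      change (X + C a) ^ K ∣ C c * g ↔ (X + C a) ^ K ∣ g
      exact (isUnit_C.mpr (isUnit_iff_ne_zero.mpr hc)).dvd_mul_left

end Wr

/-- **Proposition 3.1.** For `y ∈ Y`, `Wr(y;z)` is divisible by `(z+a)^{2k}` if and
only if `y ∈ Y_σ(a)` for some strict partition `σ ⊢ k`. -/
theorem wronskian_divisible_iff_schubertY (n : ℕ) (y : Submodule ℂ ℂ[X])
    (hy : IsOGPt n y) (h : ℂ[X]) (hw : WrEq n y h) (a : Option ℂ) (k : ℕ) :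
    rootMultCond n a (2*k) h ↔
      ∃ s : StrictPartitionIn n, swt n s = k ∧ y ∈ SchubertY n s a := by
  obtain ⟨d, hmono, hle, hsym, hfin, hroot⟩ := exists_data n y hy h hw a
  rw [hroot, comb_main hmono hle hsym]
  apply exists_congr
  intro s
  apply and_congr_right
  intro _
  constructor
  · intro hs
    refine ⟨hy, fun i hi => ?_⟩
    rw [hfin i _ hi]
    have := hs i hi
    omega
  · rintro ⟨_, hs⟩ i hi
    have := (hfin i _ hi).mp (hs i hi)
    omega

end OG
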